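/- arXiv:2504.00997 — 6 statements merged into one kernel-verified Lean document; each statement's English description precedes it below -/
import Mathlib

section
/- Assume the mechanical setting. Let q ∈ ℝⁿ and p ∈ ℝⁿ with P(q) p = p. Then for every index i, (G(q)⁻¹ p)ᵀ (∂P/∂qⁱ)(q) p = 0, where ∂P/∂qⁱ denotes the entrywise partial derivative of the matrix-valued map P in the i-th coordinate direction. (In the paper's notation: pⱼ (∂γᵏⱼ/∂qⁱ) (∂H/∂pₖ) = 0 for all i, at points of M.) -/
open scoped BigOperators Matrix
noncomputable section

/-- Phase space `ℝⁿ × ℝⁿ × ℝ`, modeling `T*Q × ℝ` for `Q = ℝⁿ`. -/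
abbrev PS (n : ℕ) := (Fin n → ℝ) × (Fin n → ℝ) × ℝ

/-- Partial derivative in the `qⁱ` direction. -/
def pdq {n : ℕ} (F : PS n → ℝ) (x : PS n) (i : Fin n) : ℝ :=
  fderiv ℝ F x (Pi.single i 1, 0, 0)

/-- Partial derivative in the `pᵢ` direction. -/
def pdp {n : ℕ} (F : PS n → ℝ) (x : PS n) (i : Fin n) : ℝ :=
  fderiv ℝ F x (0, Pi.single i 1, 0)

/-- Partial derivative in the `z` direction. -/
def pdz {n : ℕ} (F : PS n → ℝ) (x : PS n) : ℝ :=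
  fderiv ℝ F x (0, 0, 1)

/-- The flat map `♭ₓ(v) = ι_v dη + η(v) η` at `x = (q,p,z)`, for `η = dz − Σ pᵢ dqⁱ`;
covectors are identified with triples (dq-components, dp-components, dz-component). -/
def flatMap {n : ℕ} (x : PS n) (v : PS n) : PS n :=
  (fun i => -v.2.1 i - (v.2.2 - ∑ j, x.2.1 j * v.1 j) * x.2.1 i,
   v.1,
   v.2.2 - ∑ j, x.2.1 j * v.1 j)

/-- The contact Hamiltonian vector field of `F`. -/
def XH {n : ℕ} (F : PS n → ℝ) (x : PS n) : PS n :=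
  (fun i => pdp F x i,
   fun i => -pdq F x i - x.2.1 i * pdz F x,
   (∑ i, x.2.1 i * pdp F x i) - F x)

/-- The contact (Jacobi) bracket. -/
def jacB {n : ℕ} (f g : PS n → ℝ) (x : PS n) : ℝ :=
  (∑ i, (pdp f x i * pdq g x i - pdp g x i * pdq f x i))
  + (∑ i, x.2.1 i * (pdp f x i * pdz g x - pdp g x i * pdz f x))
  + g x * pdz f x - f x * pdz g x

/-- The differential of `F` at `x`, as a covector triple. -/
def dCov {n : ℕ} (F : PS n → ℝ) (x : PS n) : PS n :=
  (fun i => pdq F x i, fun i => pdp F x i, pdz F x)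

/-- The contact form `η = dz − Σ pᵢ dqⁱ` at `x`, as a covector triple. -/
def etaCov {n : ℕ} (x : PS n) : PS n :=
  (fun i => -x.2.1 i, 0, 1)

/-- The mechanical setting: a smooth Riemannian metric `G` on `ℝⁿ`, a smooth potential `V`,
and a smooth fiberwise projection `P` (idempotent, `G⁻¹`-symmetric) onto the constraint
subbundle along the annihilator of the constraint distribution. -/
structure MechSetting (n : ℕ) where
  hn : 1 ≤ n
  G : (Fin n → ℝ) → Matrix (Fin n) (Fin n) ℝ
  V : (Fin n → ℝ) × ℝ → ℝ
  P : (Fin n → ℝ) → Matrix (Fin n) (Fin n) ℝ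
  G_smooth : ∀ i j, ContDiff ℝ (⊤ : ℕ∞) (fun q => G q i j)
  G_symm : ∀ q, (G q).IsSymm
  G_posdef : ∀ q, (G q).PosDef
  V_smooth : ContDiff ℝ (⊤ : ℕ∞) V
  P_smooth : ∀ i j, ContDiff ℝ (⊤ : ℕ∞) (fun q => P q i j)
  P_proj : ∀ q, P q * P q = P q
  P_symm : ∀ q, (P q)ᵀ * (G q)⁻¹ = (G q)⁻¹ * P q

namespace MechSetting

variable {n : ℕ} (S : MechSetting n)

/-- The mechanical Hamiltonian `H(q,p,z) = ½ pᵀ G(q)⁻¹ p + V(q,z)`. -/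
def H (x : PS n) : ℝ :=
  (1 / 2) * (∑ i, ∑ j, x.2.1 i * (S.G x.1)⁻¹ i j * x.2.1 j) + S.V (x.1, x.2.2)

/-- The projection `Γ(q,p,z) = (q, P(q)p, z)` onto `M×ℝ`. -/
def Gam (x : PS n) : PS n :=
  (x.1, (S.P x.1).mulVec x.2.1, x.2.2)

/-- Membership in the constraint submanifold `M×ℝ = {(q,p,z) : P(q)p = p}`. -/
def onM (x : PS n) : Prop :=
  (S.P x.1).mulVec x.2.1 = x.2.1

/-- The constraint distribution `D(q) = {G(q)⁻¹ m : P(q) m = m}`. -/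
def Dd (q : Fin n → ℝ) : Set (Fin n → ℝ) :=
  {v | ∃ m, (S.P q).mulVec m = m ∧ v = ((S.G q)⁻¹).mulVec m}

/-- Entrywise partial derivative `∂P/∂qⁱ` of the matrix-valued map `P`. -/
def dP (q : Fin n → ℝ) (i : Fin n) : Matrix (Fin n) (Fin n) ℝ :=
  fun j k => fderiv ℝ (fun q' => S.P q' j k) q (Pi.single i 1)

end MechSetting

/-- The annihilator `D° = {α ∈ ℝⁿ : Σᵢ αᵢ vᵢ = 0 for all v ∈ D}` of a subspace `D ⊆ ℝⁿ`. -/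
def annih {n : ℕ} (D : Submodule ℝ (Fin n → ℝ)) : Submodule ℝ (Fin n → ℝ) where
  carrier := {α | ∀ v ∈ D, ∑ i, α i * v i = 0}
  zero_mem' := by intro v hv; simp
  add_mem' := by
    intro a b ha hb v hv
    have h1 := ha v hv
    have h2 := hb v hv
    simp only [Pi.add_apply, add_mul, Finset.sum_add_distrib, h1, h2, add_zero]
  smul_mem' := by
    intro c a ha v hv
    simp only [Pi.smul_apply, smul_eq_mul, mul_assoc, ← Finset.mul_sum, ha v hv, mul_zero]

/-- The Leibniz rule applied to `P² = P`. -/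
lemma MechSetting.dP_eq_dP_mul_add_mul_dP {n : ℕ} (S : MechSetting n) (q : Fin n → ℝ)
    (i : Fin n) : S.dP q i = S.dP q i * S.P q + S.P q * S.dP q i := by
  have hd (j k : Fin n) : DifferentiableAt ℝ (fun q' => S.P q' j k) q :=
    (S.P_smooth j k).differentiable (by simp) q
  ext j k
  have hP : (fun q' => S.P q' j k) = fun q' => ∑ l, S.P q' j l * S.P q' l k := by
    funext q'
    rw [← Matrix.mul_apply, S.P_proj]
  have h : HasFDerivAt (fun q' => ∑ l, S.P q' j l * S.P q' l k) _ q :=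
    HasFDerivAt.fun_sum fun l _ => (hd j l).hasFDerivAt.mul (hd l k).hasFDerivAt
  calc S.dP q i j k
      = fderiv ℝ (fun q' => ∑ l, S.P q' j l * S.P q' l k) q (Pi.single i 1) := by
        rw [← hP]; rfl
    _ = ∑ l, (S.P q j l * S.dP q i l k + S.P q l k * S.dP q i j l) := by
        rw [h.fderiv]
        simp [MechSetting.dP]
    _ = (S.dP q i * S.P q + S.P q * S.dP q i) j k := by
        rw [Matrix.add_apply, Matrix.mul_apply, Matrix.mul_apply, ← Finset.sum_add_distrib]
        exact Finset.sum_congr rfl fun l _ => by ring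

/-- at points of `M`, `(G(q)⁻¹ p)ᵀ (∂P/∂qⁱ)(q) p = 0` for all `i`. -/
theorem statement_5 {n : ℕ} (S : MechSetting n) (q p : Fin n → ℝ)
    (hp : (S.P q).mulVec p = p) :
    ∀ i, ((S.G q)⁻¹.mulVec p) ⬝ᵥ (S.dP q i).mulVec p = 0 := by
  intro i
  have hw : Matrix.vecMul ((S.G q)⁻¹.mulVec p) (S.P q) = (S.G q)⁻¹.mulVec p := by
    rw [← Matrix.mulVec_transpose, Matrix.mulVec_mulVec, S.P_symm, ← Matrix.mulVec_mulVec, hp]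
  have h := congrArg (fun A => ((S.G q)⁻¹.mulVec p) ⬝ᵥ A.mulVec p)
    (S.dP_eq_dP_mul_add_mul_dP q i)
  simp only [Matrix.add_mulVec, dotProduct_add, ← Matrix.mulVec_mulVec, hp] at h
  rw [Matrix.dotProduct_mulVec _ (S.P q), hw] at h
  linarith
end
end

section
/- Assume the mechanical setting. Then for every x = (q, p, z) with P(q) p = p, the total (Fréchet) derivatives of H ∘ Γ and of H at x are equal as linear maps ℝⁿ × ℝⁿ × ℝ → ℝ: d(H∘Γ)(x) = dH(x). In particular ∂(H∘Γ)/∂qⁱ = ∂H/∂qⁱ, ∂(H∘Γ)/∂pᵢ = ∂H/∂pᵢ, and ∂(H∘Γ)/∂z = ∂H/∂z at every point of M×ℝ. -/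
open scoped BigOperators Matrix
noncomputable section

theorem Matrix.differentiable_det_of_entries {E m : Type*} [NormedAddCommGroup E]
    [NormedSpace ℝ E] [Fintype m] [DecidableEq m] {A : E → Matrix m m ℝ}
    (hA : ∀ i j, Differentiable ℝ fun y => A y i j) :
    Differentiable ℝ fun y => (A y).det := by
  simp only [Matrix.det_apply']
  fun_prop

theorem Matrix.differentiable_inv_of_entries {E m : Type*} [NormedAddCommGroup E]
    [NormedSpace ℝ E] [Fintype m] [DecidableEq m] {A : E → Matrix m m ℝ}
    (hA : ∀ i j, Differentiable ℝ fun y => A y i j) (hdet : ∀ y, (A y).det ≠ 0) (i j : m) :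
    Differentiable ℝ fun y => (A y)⁻¹ i j := by
  simp only [Matrix.inv_def, Ring.inverse_eq_inv', Matrix.smul_apply, Matrix.adjugate_apply,
    smul_eq_mul]
  refine ((Matrix.differentiable_det_of_entries hA).inv hdet).mul
    (Matrix.differentiable_det_of_entries fun k l => ?_)
  by_cases h : k = j
  · simp [h]
  · simpa [Matrix.updateRow_apply, h] using hA k l

/-- Pythagoras for a `W`-self-adjoint projection. -/
theorem Matrix.dotProduct_mulVec_eq_add_of_proj {m R : Type*} [CommRing R] [Fintype m]
    {W P : Matrix m m R} (hP : P * P = P) (hW : Pᵀ * W = W * P) (u : m → R) :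
    u ⬝ᵥ W *ᵥ u =
      (P *ᵥ u) ⬝ᵥ W *ᵥ (P *ᵥ u) + (u - P *ᵥ u) ⬝ᵥ W *ᵥ (u - P *ᵥ u) := by
  have hmove (a b : m → R) : (P *ᵥ a) ⬝ᵥ W *ᵥ b = a ⬝ᵥ W *ᵥ (P *ᵥ b) := by
    rw [Matrix.mulVec_mulVec, ← hW, ← Matrix.mulVec_mulVec, Matrix.dotProduct_mulVec a,
      Matrix.vecMul_transpose]
  have hPP : P *ᵥ (P *ᵥ u) = P *ᵥ u := by rw [Matrix.mulVec_mulVec, hP]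
  simp only [Matrix.mulVec_sub, dotProduct_sub, sub_dotProduct, hmove, hPP]
  ring

theorem hasFDerivAt_sum_mul_mul_of_eq_zero {E m : Type*} [NormedAddCommGroup E]
    [NormedSpace ℝ E] [Fintype m] {r : E → m → ℝ} {W : E → Matrix m m ℝ} {x : E}
    (hr : ∀ i, DifferentiableAt ℝ (fun y => r y i) x)
    (hW : ∀ i j, DifferentiableAt ℝ (fun y => W y i j) x) (h0 : r x = 0) :
    HasFDerivAt (fun y => ∑ i, ∑ j, r y i * W y i j * r y j) (0 : E →L[ℝ] ℝ) x := by
  have h (i j : m) : HasFDerivAt (fun y => r y i * W y i j * r y j) (0 : E →L[ℝ] ℝ) x := by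
    simpa [h0] using
      ((hr i).hasFDerivAt.fun_mul (hW i j).hasFDerivAt).fun_mul (hr j).hasFDerivAt
  simpa using HasFDerivAt.fun_sum fun i (_ : i ∈ Finset.univ) =>
    HasFDerivAt.fun_sum fun j (_ : j ∈ Finset.univ) => h i j

theorem Matrix.sum_sum_mul_mul_eq_dotProduct {m R : Type*} [CommSemiring R] [Fintype m]
    (W : Matrix m m R) (u : m → R) :
    ∑ i, ∑ j, u i * W i j * u j = u ⬝ᵥ W *ᵥ u := by
  simp only [dotProduct, Matrix.mulVec, Finset.mul_sum, mul_assoc]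

namespace MechSetting

variable {n : ℕ} (S : MechSetting n)

theorem differentiable_inv_metric (i j : Fin n) :
    Differentiable ℝ fun y : PS n => (S.G y.1)⁻¹ i j :=
  (Matrix.differentiable_inv_of_entries (fun k l => (S.G_smooth k l).differentiable (by simp))
    (fun q => (S.G_posdef q).det_pos.ne') i j).comp differentiable_fst

theorem differentiable_H : Differentiable ℝ S.H := by
  have hW := S.differentiable_inv_metric
  have hV : Differentiable ℝ S.V := S.V_smooth.differentiable (by simp)
  have hVy : Differentiable ℝ fun y : PS n => S.V (y.1, y.2.2) := hV.comp (by fun_prop)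
  refine Differentiable.fun_add (Differentiable.const_mul ?_ _) hVy
  refine Differentiable.fun_sum fun i _ => Differentiable.fun_sum fun j _ => ?_
  exact (Differentiable.fun_mul (by fun_prop) (hW i j)).fun_mul (by fun_prop)

theorem differentiable_sub_proj (i : Fin n) :
    Differentiable ℝ fun y : PS n => (y.2.1 - S.P y.1 *ᵥ y.2.1) i := by
  have hP (j : Fin n) : Differentiable ℝ fun y : PS n => S.P y.1 i j :=
    ((S.P_smooth i j).differentiable (by simp)).comp differentiable_fst
  simp only [Pi.sub_apply, Matrix.mulVec, dotProduct]
  fun_prop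

theorem H_comp_Gam_eq :
    S.H ∘ S.Gam = fun y => S.H y - (1 / 2) * ∑ i, ∑ j,
      (y.2.1 - S.P y.1 *ᵥ y.2.1) i * (S.G y.1)⁻¹ i j * (y.2.1 - S.P y.1 *ᵥ y.2.1) j := by
  funext y
  simp only [Function.comp_apply, H, Gam, Matrix.sum_sum_mul_mul_eq_dotProduct,
    Matrix.dotProduct_mulVec_eq_add_of_proj (S.P_proj y.1) (S.P_symm y.1) y.2.1]
  ring

end MechSetting

/-- on `M×ℝ`, the total derivatives of `H ∘ Γ` and `H` coincide. -/
theorem statement_6 {n : ℕ} (S : MechSetting n) (x : PS n) (hx : S.onM x) :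
    fderiv ℝ (S.H ∘ S.Gam) x = fderiv ℝ S.H x := by
  have hQ := hasFDerivAt_sum_mul_mul_of_eq_zero (fun i => S.differentiable_sub_proj i x)
    (fun i j => S.differentiable_inv_metric i j x) (sub_eq_zero.2 (Eq.symm hx))
  rw [S.H_comp_Gam_eq]
  simpa using ((S.differentiable_H x).hasFDerivAt.fun_sub (hQ.const_mul (1 / 2))).fderiv
end
end

section
/- Assume the mechanical setting. Then the contact Hamiltonian vector fields of H and of H ∘ Γ coincide at every point of the constraint submanifold: for every x = (q, p, z) with P(q) p = p, X_{H∘Γ}(x) = X_H(x). -/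
open scoped BigOperators Matrix
noncomputable section

theorem differentiable_matrix_det {E : Type*} [NormedAddCommGroup E] [NormedSpace ℝ E] {n : ℕ}
    {A : E → Matrix (Fin n) (Fin n) ℝ} (hA : ∀ i j, Differentiable ℝ fun q => A q i j) :
    Differentiable ℝ fun q => (A q).det := by
  simp only [Matrix.det_apply']
  fun_prop

theorem differentiable_matrix_inv_apply {E : Type*} [NormedAddCommGroup E] [NormedSpace ℝ E]
    {n : ℕ} {A : E → Matrix (Fin n) (Fin n) ℝ} (hA : ∀ i j, Differentiable ℝ fun q => A q i j)
    (hdet : ∀ q, (A q).det ≠ 0) (i j : Fin n) :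
    Differentiable ℝ fun q => (A q)⁻¹ i j := by
  simp only [Matrix.inv_def, Matrix.smul_apply, smul_eq_mul, Ring.inverse_eq_inv',
    Matrix.adjugate_apply]
  refine ((differentiable_matrix_det hA).inv hdet).mul (differentiable_matrix_det fun k l => ?_)
  simp only [Matrix.updateRow_apply]
  split_ifs
  · exact differentiable_const _
  · exact hA k l

namespace MechSetting

theorem H_eq_dotProduct {n : ℕ} (S : MechSetting n) (x : PS n) :
    S.H x = (1 / 2) * (x.2.1 ⬝ᵥ (S.G x.1)⁻¹ *ᵥ x.2.1) + S.V (x.1, x.2.2) := by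
  simp only [H, dotProduct, Matrix.mulVec, Finset.mul_sum, mul_assoc]

theorem differentiable_H_s7 {n : ℕ} (S : MechSetting n) : Differentiable ℝ S.H := by
  have hG : ∀ i j, Differentiable ℝ fun q => (S.G q)⁻¹ i j :=
    differentiable_matrix_inv_apply (fun i j => (S.G_smooth i j).differentiable (by simp))
      fun q => (S.G_posdef q).det_pos.ne'
  have hG' : ∀ i j, Differentiable ℝ fun x : PS n => (S.G x.1)⁻¹ i j :=
    fun i j => (hG i j).comp differentiable_fst
  have hV : Differentiable ℝ S.V := S.V_smooth.differentiable (by simp)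
  have hp (i : Fin n) : Differentiable ℝ fun x : PS n => x.2.1 i := by fun_prop
  have hK : Differentiable ℝ fun x : PS n =>
      ∑ i, ∑ j, x.2.1 i * (S.G x.1)⁻¹ i j * x.2.1 j :=
    Differentiable.fun_sum fun i _ => Differentiable.fun_sum fun j _ =>
      ((hp i).mul (hG' i j)).mul (hp j)
  have hqz : Differentiable ℝ fun x : PS n => (x.1, x.2.2) := by fun_prop
  exact (hK.const_mul (1 / 2)).add (hV.comp hqz)

theorem differentiable_Gam {n : ℕ} (S : MechSetting n) : Differentiable ℝ S.Gam := by
  have hP : ∀ i j, Differentiable ℝ fun x : PS n => S.P x.1 i j :=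
    fun i j => ((S.P_smooth i j).differentiable (by simp)).comp differentiable_fst
  have hPp : Differentiable ℝ fun x : PS n => S.P x.1 *ᵥ x.2.1 := by
    refine differentiable_pi.2 fun i => ?_
    simp only [Matrix.mulVec, dotProduct]
    fun_prop
  unfold Gam
  fun_prop

/-- The Pythagorean identity for the `G⁻¹`-orthogonal projection `P`. -/
theorem H_sub_H_Gam {n : ℕ} (S : MechSetting n) (x : PS n) :
    S.H x - S.H (S.Gam x) =
      (1 / 2) * ((x.2.1 - S.P x.1 *ᵥ x.2.1) ⬝ᵥ
        (S.G x.1)⁻¹ *ᵥ (x.2.1 - S.P x.1 *ᵥ x.2.1)) := by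
  have h (v : Fin n → ℝ) : (S.P x.1 *ᵥ x.2.1) ⬝ᵥ (S.G x.1)⁻¹ *ᵥ v =
      x.2.1 ⬝ᵥ (S.G x.1)⁻¹ *ᵥ (S.P x.1 *ᵥ v) := by
    rw [Matrix.mulVec_mulVec, ← S.P_symm, ← Matrix.mulVec_mulVec,
      Matrix.dotProduct_mulVec x.2.1, Matrix.vecMul_transpose]
  have hPP : S.P x.1 *ᵥ (S.P x.1 *ᵥ x.2.1) = S.P x.1 *ᵥ x.2.1 := by
    rw [Matrix.mulVec_mulVec, S.P_proj]
  simp only [H_eq_dotProduct, Gam, sub_dotProduct, h, Matrix.mulVec_sub, dotProduct_sub, hPP]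
  ring

theorem H_Gam_le {n : ℕ} (S : MechSetting n) (x : PS n) : S.H (S.Gam x) ≤ S.H x := by
  have h := (S.G_posdef x.1).inv.posSemidef.dotProduct_mulVec_nonneg
    (x.2.1 - S.P x.1 *ᵥ x.2.1)
  rw [star_trivial] at h
  linarith [S.H_sub_H_Gam x]

theorem Gam_eq_self {n : ℕ} (S : MechSetting n) {x : PS n} (hx : S.onM x) : S.Gam x = x := by
  rw [Gam, hx]

/-- On `M × ℝ` the nonnegative function `H - H ∘ Γ` attains its minimum `0`. -/
theorem fderiv_H_comp_Gam {n : ℕ} (S : MechSetting n) {x : PS n} (hx : S.onM x) :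
    fderiv ℝ (S.H ∘ S.Gam) x = fderiv ℝ S.H x := by
  have hmin : IsLocalMin (S.H - S.H ∘ S.Gam) x := by
    refine Filter.Eventually.of_forall fun y => ?_
    simpa [S.Gam_eq_self hx] using S.H_Gam_le y
  have h := hmin.fderiv_eq_zero
  rw [fderiv_sub (S.differentiable_H_s7 x) ((S.differentiable_H_s7.comp S.differentiable_Gam) x)] at h
  exact (sub_eq_zero.1 h).symm

end MechSetting

/-- the contact Hamiltonian vector fields of `H` and `H ∘ Γ` coincide on `M×ℝ`. -/
theorem statement_7 {n : ℕ} (S : MechSetting n) (x : PS n) (hx : S.onM x) :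
    XH (S.H ∘ S.Gam) x = XH S.H x := by
  simp only [XH, pdq, pdp, pdz, S.fderiv_H_comp_Gam hx, Function.comp_apply, S.Gam_eq_self hx]
end
end

section
/- Assume the mechanical setting, and for x = (q,p,z) ∈ M×ℝ define Y(x) := DΓ(x) · X_H(x), the image of the contact Hamiltonian vector field under the derivative of the projection Γ. Then: (i) Y is tangent to M×ℝ, i.e., writing Y(x) = (A, B, C) ∈ ℝⁿ×ℝⁿ×ℝ, one has Σᵢ Aᵢ (∂P/∂qⁱ)(q) p + P(q) B = B; and (ii) the covector ♭ₓ(Y(x)) − dH(x) + (H(x) + ∂H/∂z(x)) ηₓ has vanishing dp-components and vanishing dz-component, and its dq-component β ∈ ℝⁿ satisfies Σᵢ βᵢ vᵢ = 0 for every v ∈ D(q). (That is, Y solves the constrained contact Hamilton equations, Y = X_{H,M}.) -/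
open scoped BigOperators Matrix
noncomputable section

namespace MechSetting

variable {n : ℕ} (S : MechSetting n)

lemma differentiableAt_P (q : Fin n → ℝ) (j k : Fin n) :
    DifferentiableAt ℝ (fun q' => S.P q' j k) q :=
  (S.P_smooth j k).contDiffAt.differentiableAt (by simp)

lemma fderiv_P_apply (q w : Fin n → ℝ) (j k : Fin n) :
    fderiv ℝ (fun q' => S.P q' j k) q w = ∑ i, w i * S.dP q i j k := by
  conv_lhs => rw [pi_eq_sum_univ' w]
  simp only [map_sum, map_smul, smul_eq_mul, dP]

lemma dP_mul_add_mul_dP (q : Fin n → ℝ) (i : Fin n) :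
    S.dP q i * S.P q + S.P q * S.dP q i = S.dP q i := by
  ext j k
  have hP : (fun q' => S.P q' j k) = fun q' => ∑ l, S.P q' j l * S.P q' l k := by
    funext q'
    rw [← Matrix.mul_apply, S.P_proj]
  have hd : HasFDerivAt (fun q' => ∑ l, S.P q' j l * S.P q' l k) _ q :=
    HasFDerivAt.fun_sum fun l _ =>
      (S.differentiableAt_P q j l).hasFDerivAt.mul (S.differentiableAt_P q l k).hasFDerivAt
  conv_rhs => rw [dP, hP, hd.fderiv]
  simp only [Matrix.add_apply, Matrix.mul_apply, ← Finset.sum_add_distrib,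
    sum_apply, add_apply, smul_apply,
    smul_eq_mul]
  exact Finset.sum_congr rfl fun l _ => by simp only [dP]; ring

/-- The derivative of `P` along `M` has values in the kernel of `P`. -/
lemma P_mulVec_dP_mulVec {q p : Fin n → ℝ} (hp : S.P q *ᵥ p = p) (i : Fin n) :
    S.P q *ᵥ (S.dP q i *ᵥ p) = 0 := by
  have h := congrArg (· *ᵥ p) (S.dP_mul_add_mul_dP q i)
  simpa [Matrix.add_mulVec, ← Matrix.mulVec_mulVec, hp] using h

lemma P_mulVec_sum_dP_mulVec {q p : Fin n → ℝ} (hp : S.P q *ᵥ p = p) (w : Fin n → ℝ) :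
    S.P q *ᵥ (∑ i, w i • S.dP q i *ᵥ p) = 0 := by
  simp [Matrix.mulVec_sum, Matrix.mulVec_smul, S.P_mulVec_dP_mulVec hp]

lemma fderiv_Gam_apply (x w : PS n) :
    fderiv ℝ S.Gam x w =
      (w.1, (∑ i, w.1 i • S.dP x.1 i *ᵥ x.2.1) + S.P x.1 *ᵥ w.2.1, w.2.2) := by
  have hq : HasFDerivAt (fun y : PS n => y.1) (ContinuousLinearMap.fst ℝ _ _) x :=
    hasFDerivAt_fst
  have hpz : HasFDerivAt (fun y : PS n => y.2) (ContinuousLinearMap.snd ℝ _ _) x :=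
    hasFDerivAt_snd
  have hP (j k : Fin n) := (S.differentiableAt_P x.1 j k).hasFDerivAt.comp x hq
  have hp (k : Fin n) : HasFDerivAt (fun y : PS n => y.2.1 k) _ x :=
    hasFDerivAt_pi'.1 hpz.fst k
  have hPp : HasFDerivAt (fun y : PS n => S.P y.1 *ᵥ y.2.1) _ x :=
    hasFDerivAt_pi.2 fun j =>
      HasFDerivAt.fun_sum (u := Finset.univ) fun k _ => (hP j k).mul (hp k)
  have hG : HasFDerivAt S.Gam _ x := hq.prodMk (hPp.prodMk hpz.snd)
  rw [hG.fderiv]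
  refine Prod.ext rfl (Prod.ext (funext fun j => ?_) rfl)
  simp [fderiv_P_apply, Matrix.mulVec, dotProduct, Finset.sum_add_distrib, Finset.mul_sum]
  rw [Finset.sum_comm, add_comm]
  congr 1
  refine Finset.sum_congr rfl fun i _ => Finset.sum_congr rfl fun k _ => ?_
  ring

/-- The kernel of `P(q)` annihilates the constraint distribution. -/
lemma dotProduct_eq_zero_of_mem_Dd {q u v : Fin n → ℝ} (hu : S.P q *ᵥ u = 0)
    (hv : v ∈ S.Dd q) : u ⬝ᵥ v = 0 := by
  obtain ⟨m, hm, rfl⟩ := hv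
  rw [← hm, Matrix.mulVec_mulVec, ← S.P_symm, ← Matrix.mulVec_mulVec, Matrix.dotProduct_mulVec,
    Matrix.vecMul_transpose, hu, zero_dotProduct]

end MechSetting

/-- `Y := TΓ(X_H)` is tangent to `M×ℝ` and solves the constrained contact
Hamilton equations, i.e. `Y = X_{H,M}`. -/
theorem statement_10 {n : ℕ} (S : MechSetting n) (x : PS n) (hx : S.onM x)
    (Y : PS n) (hY : Y = fderiv ℝ S.Gam x (XH S.H x)) :
    ((∑ i, Y.1 i • (S.dP x.1 i).mulVec x.2.1) + (S.P x.1).mulVec Y.2.1 = Y.2.1)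
      ∧ ((flatMap x Y - dCov S.H x + (S.H x + pdz S.H x) • etaCov x).2.1 = 0
        ∧ (flatMap x Y - dCov S.H x + (S.H x + pdz S.H x) • etaCov x).2.2 = 0
        ∧ ∀ v ∈ S.Dd x.1,
            (∑ i, (flatMap x Y - dCov S.H x + (S.H x + pdz S.H x) • etaCov x).1 i * v i) = 0) := by
  subst hY
  rw [S.fderiv_Gam_apply]
  have hPdP := S.P_mulVec_sum_dP_mulVec hx (XH S.H x).1
  have hPP (u : Fin n → ℝ) : S.P x.1 *ᵥ (S.P x.1 *ᵥ u) = S.P x.1 *ᵥ u := by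
    rw [Matrix.mulVec_mulVec, S.P_proj]
  refine ⟨?_, ?_, ?_, fun v hv => ?_⟩
  · simp only [Matrix.mulVec_add, hPdP, hPP, zero_add]
  · ext i
    simp [flatMap, dCov, etaCov, XH]
  · simp [flatMap, dCov, etaCov, XH]
  · refine S.dotProduct_eq_zero_of_mem_Dd
      (u := (XH S.H x).2.1
        - ((∑ i, (XH S.H x).1 i • S.dP x.1 i *ᵥ x.2.1) + S.P x.1 *ᵥ (XH S.H x).2.1)) ?_ hv
      |>.symm.trans ?_ |>.symm
    · simp only [Matrix.mulVec_sub, Matrix.mulVec_add, hPdP, hPP, zero_add, sub_self]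
    · refine Finset.sum_congr rfl fun i _ => ?_
      simp [flatMap, dCov, etaCov, XH]
      ring_nf
      simp
end
end

section
/- Assume the mechanical setting. Let g : ℝⁿ × ℝⁿ × ℝ → ℝ be a smooth function that vanishes on M×ℝ (for instance, any of the constraint functions φᵃ defining M). Then g is a Casimir of the contact Eden bracket: for every smooth f : ℝⁿ × ℝⁿ × ℝ → ℝ and every x ∈ M×ℝ, {f, g}_E(x) = 0. -/
open scoped BigOperators Matrix
noncomputable section

/-- `Γ` takes values in `M×ℝ`, on the whole of phase space. -/
theorem MechSetting.onM_Gam {n : ℕ} (S : MechSetting n) (y : PS n) : S.onM (S.Gam y) := by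
  simp [MechSetting.onM, MechSetting.Gam, Matrix.mulVec_mulVec, S.P_proj]

/-- any smooth function vanishing on `M×ℝ` is a Casimir of the
contact Eden bracket `{f,g}_E = {f∘Γ, g∘Γ}|_{M×ℝ}`. -/
theorem statement_12 {n : ℕ} (S : MechSetting n) (g : PS n → ℝ)
    (hg : ContDiff ℝ (⊤ : ℕ∞) g) (hg0 : ∀ x : PS n, S.onM x → g x = 0)
    (f : PS n → ℝ) (hf : ContDiff ℝ (⊤ : ℕ∞) f) (x : PS n) (hx : S.onM x) :
    jacB (f ∘ S.Gam) (g ∘ S.Gam) x = 0 := by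
  have h : g ∘ S.Gam = fun _ => 0 := by
    funext y
    exact hg0 _ (S.onM_Gam y)
  rw [h]
  simp [jacB, pdq, pdp, pdz]
end
end

section
/- Assume the mechanical setting. Let f, g : ℝⁿ × ℝⁿ × ℝ → ℝ be smooth and both satisfy the mechanical condition: for every x = (q,p,z) ∈ M×ℝ, the p-gradients ∇_p f(x) and ∇_p g(x) lie in D(q). Then the contact Eden bracket of f and g agrees with the canonical contact (Jacobi) bracket at every point of the constraint submanifold: {f, g}_E(x) = {f, g}(x) for all x ∈ M×ℝ. (Thus on this vector subspace of observables the dynamics remain unconstrained.) -/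
open scoped BigOperators Matrix
noncomputable section

namespace MechSetting

variable {n : ℕ} (S : MechSetting n)

/-- The directional derivative of the matrix-valued map `P`. -/
def dirP (q a : Fin n → ℝ) : Matrix (Fin n) (Fin n) ℝ :=
  fun j k => fderiv ℝ (fun q' => S.P q' j k) q a

lemma hasFDerivAt_P (q : Fin n → ℝ) (j k : Fin n) :
    HasFDerivAt (fun q' => S.P q' j k) (fderiv ℝ (fun q' => S.P q' j k) q) q :=
  ((S.P_smooth j k).differentiable (by simp) q).hasFDerivAt

lemma dirP_eq (q a : Fin n → ℝ) :
    S.dirP q a = S.P q * S.dirP q a + S.dirP q a * S.P q := by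
  ext j k
  have h := HasFDerivAt.fun_sum (u := Finset.univ)
    fun l _ => (S.hasFDerivAt_P q j l).mul (S.hasFDerivAt_P q l k)
  have hP : (fun q' => S.P q' j k) = fun q' => ∑ l, S.P q' j l * S.P q' l k := by
    funext q'
    rw [← Matrix.mul_apply, S.P_proj]
  have h' := congrArg (fun A => A a) ((hP ▸ h).fderiv)
  simpa [dirP, Matrix.mul_apply, Finset.sum_add_distrib, mul_comm] using h'

/-- The derivative of a projection has no diagonal block on its range. -/
lemma P_mul_dirP_mul_P (q a : Fin n → ℝ) : S.P q * S.dirP q a * S.P q = 0 := by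
  have h := congrArg (fun A => S.P q * A * S.P q) (S.dirP_eq q a)
  have h1 : S.P q * (S.P q * S.dirP q a + S.dirP q a * S.P q) * S.P q
      = S.P q * S.dirP q a * S.P q + S.P q * S.dirP q a * S.P q := by
    rw [mul_add, add_mul, ← mul_assoc, S.P_proj, ← mul_assoc (S.P q) (S.dirP q a) (S.P q),
      mul_assoc (S.P q * S.dirP q a) (S.P q) (S.P q), S.P_proj]
  simp only [h1] at h
  simpa using h

lemma vecMul_P_of_mem_Dd {q u : Fin n → ℝ} (hu : u ∈ S.Dd q) : u ᵥ* S.P q = u := by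
  obtain ⟨m, hm, rfl⟩ := hu
  rw [← Matrix.mulVec_transpose, Matrix.mulVec_mulVec, S.P_symm, ← Matrix.mulVec_mulVec, hm]

lemma dotProduct_dirP_mulVec {q u p : Fin n → ℝ} (a : Fin n → ℝ) (hu : u ∈ S.Dd q)
    (hp : S.P q *ᵥ p = p) : u ⬝ᵥ (S.dirP q a *ᵥ p) = 0 := by
  rw [← S.vecMul_P_of_mem_Dd hu, ← hp, ← Matrix.dotProduct_mulVec, Matrix.mulVec_mulVec,
    Matrix.mulVec_mulVec, S.P_mul_dirP_mul_P, Matrix.zero_mulVec, dotProduct_zero]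

lemma exists_hasFDerivAt_Gam (x : PS n) :
    ∃ L : PS n →L[ℝ] PS n, HasFDerivAt S.Gam L x ∧
      ∀ v, L v = (v.1, S.dirP x.1 v.1 *ᵥ x.2.1 + S.P x.1 *ᵥ v.2.1, v.2.2) := by
  have hp (k : Fin n) := hasFDerivAt_pi'.1 (hasFDerivAt_snd (𝕜 := ℝ) (p := x)).fst k
  have hP (j k : Fin n) := (S.hasFDerivAt_P x.1 j k).comp x
    (hasFDerivAt_fst (𝕜 := ℝ) (p := x))
  have h := hasFDerivAt_pi.2 fun j => HasFDerivAt.fun_sum (u := Finset.univ)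
    fun k _ => (hP j k).mul (hp k)
  refine ⟨_, (hasFDerivAt_fst (𝕜 := ℝ) (p := x)).prodMk
    (h.prodMk (hasFDerivAt_snd (𝕜 := ℝ) (p := x)).snd), fun v => ?_⟩
  refine Prod.ext rfl (Prod.ext ?_ rfl)
  ext j
  simp [dirP, Matrix.mulVec, dotProduct, Finset.sum_add_distrib, mul_comm, add_comm]

end MechSetting

lemma fderiv_momentum_eq_dotProduct {n : ℕ} (f : PS n → ℝ) (x : PS n) (w : Fin n → ℝ) :
    fderiv ℝ f x (0, w, 0) = (fun i => pdp f x i) ⬝ᵥ w := by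
  let ι : (Fin n → ℝ) →ₗ[ℝ] PS n := LinearMap.inr ℝ _ _ ∘ₗ LinearMap.inl ℝ _ _
  have h := LinearMap.pi_apply_eq_sum_univ ((fderiv ℝ f x).toLinearMap ∘ₗ ι) w
  have hsingle (i : Fin n) : (fun j => if i = j then (1 : ℝ) else 0) = Pi.single i 1 := by
    ext j
    simp [Pi.single_apply, eq_comm]
  simp only [hsingle] at h
  simpa [ι, pdp, dotProduct, mul_comm] using h

/-- The projection `Γ` does not change the differential of a mechanical observable. -/
lemma MechSetting.fderiv_comp_Gam {n : ℕ} (S : MechSetting n) {f : PS n → ℝ} {x : PS n}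
    (hf : DifferentiableAt ℝ f x) (hx : S.onM x) (hmech : (fun i => pdp f x i) ∈ S.Dd x.1) :
    fderiv ℝ (f ∘ S.Gam) x = fderiv ℝ f x := by
  obtain ⟨L, hL, hLv⟩ := S.exists_hasFDerivAt_Gam x
  have hG : S.Gam x = x := Prod.ext rfl (Prod.ext hx rfl)
  have hf' : HasFDerivAt f (fderiv ℝ f x) (S.Gam x) := by
    rw [hG]
    exact hf.hasFDerivAt
  rw [(hf'.comp x hL).fderiv]
  refine ContinuousLinearMap.ext fun v => ?_
  have split (w : Fin n → ℝ) :
      fderiv ℝ f x (v.1, w, v.2.2) = fderiv ℝ f x (v.1, 0, v.2.2) + (fun i => pdp f x i) ⬝ᵥ w := by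
    rw [← fderiv_momentum_eq_dotProduct, ← map_add]
    simp
  rw [ContinuousLinearMap.comp_apply, hLv, split, dotProduct_add,
    S.dotProduct_dirP_mulVec _ hmech hx, zero_add, Matrix.dotProduct_mulVec,
    S.vecMul_P_of_mem_Dd hmech, ← split]

/-- for observables satisfying the mechanical condition, the contact Eden
bracket agrees with the canonical contact (Jacobi) bracket on `M×ℝ`. -/
theorem statement_18 {n : ℕ} (S : MechSetting n)
    (f g : PS n → ℝ) (hf : ContDiff ℝ (⊤ : ℕ∞) f) (hg : ContDiff ℝ (⊤ : ℕ∞) g)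
    (hmechf : ∀ x : PS n, S.onM x → (fun i => pdp f x i) ∈ S.Dd x.1)
    (hmechg : ∀ x : PS n, S.onM x → (fun i => pdp g x i) ∈ S.Dd x.1) :
    ∀ x : PS n, S.onM x → jacB (f ∘ S.Gam) (g ∘ S.Gam) x = jacB f g x := by
  intro x hx
  have hG : S.Gam x = x := Prod.ext rfl (Prod.ext hx rfl)
  simp only [jacB, pdp, pdq, pdz, Function.comp_apply, hG,
    S.fderiv_comp_Gam (hf.differentiable (by simp) x) hx (hmechf x hx),
    S.fderiv_comp_Gam (hg.differentiable (by simp) x) hx (hmechg x hx)]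
end
end
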